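/- For each q ∈ B there exists u ∈ B with u ≤ P_{ψ(u)}q, ψ(u) ≥ 0, and ψ(u) ≤ α(q) ≤ 2ψ(u), where P_{ψ(u)} denotes the band projection onto the band in E generated by ψ(u). -/

import Mathlib

/-- In a (Dedekind complete) Riesz space `E`, the band projection of `x` onto the
band generated by `u`, given by `P_u x = sup_n (x⁺ ⊓ n|u|) - sup_n (x⁻ ⊓ n|u|)`.
For a component `p` of a weak order unit this is the product `p x`. -/
noncomputable def bandProj {E : Type*} [AddCommGroup E] [ConditionallyCompleteLattice E]
    [CovariantClass E E (· + ·) (· ≤ ·)] (u x : E) : E :=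
  sSup (Set.range fun n : ℕ => (x ⊔ 0) ⊓ n • |u|) -
    sSup (Set.range fun n : ℕ => ((-x) ⊔ 0) ⊓ n • |u|)

/-- `p` is a component of the weak order unit `e`: `0 ≤ p ≤ e` and `p ∧ (e - p) = 0`. -/
def IsComponent {E : Type*} [AddCommGroup E] [Lattice E] (e p : E) : Prop :=
  0 ≤ p ∧ p ≤ e ∧ p ⊓ (e - p) = 0

/-- The setting of the abstract Hahn-Jordan decomposition: a Dedekind complete Riesz
space `E` with weak order unit `e`, a Dedekind complete Riesz subspace `G` of `E`
containing `e`, an order closed Boolean subalgebra `B` of the components of `e`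
containing all components of `e` lying in `G`, and a map `ψ : B → G` which is
`K_G(e)`-homogeneous, additive on disjoint components, order continuous and order
bounded. -/
structure HJSetup (E : Type*) [AddCommGroup E] [ConditionallyCompleteLattice E]
    [CovariantClass E E (· + ·) (· ≤ ·)] [Module ℝ E] [PosSMulMono ℝ E] where
  /-- the weak order unit -/
  e : E
  /-- the Dedekind complete Riesz subspace `G` -/
  G : Set E
  /-- the Boolean algebra `B` of components of `e` -/
  B : Set E
  /-- the map `ψ : B → G` (values outside `B` are irrelevant) -/
  ψ : E → E
  e_pos : 0 < e
  e_weak : ∀ x : E, 0 ≤ x → x ⊓ e = 0 → x = 0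
  G_zero : (0 : E) ∈ G
  G_add : ∀ x ∈ G, ∀ y ∈ G, x + y ∈ G
  G_neg : ∀ x ∈ G, -x ∈ G
  G_smul : ∀ (c : ℝ), ∀ x ∈ G, c • x ∈ G
  G_sup : ∀ x ∈ G, ∀ y ∈ G, x ⊔ y ∈ G
  G_inf : ∀ x ∈ G, ∀ y ∈ G, x ⊓ y ∈ G
  /-- `G` is Dedekind complete (order closed in `E`) -/
  G_ded : ∀ S ⊆ G, S.Nonempty → BddAbove S → sSup S ∈ G
  e_mem : e ∈ G
  B_comp : ∀ p ∈ B, IsComponent e p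
  B_zero : (0 : E) ∈ B
  B_top : e ∈ B
  B_sup : ∀ p ∈ B, ∀ q ∈ B, p ⊔ q ∈ B
  B_inf : ∀ p ∈ B, ∀ q ∈ B, p ⊓ q ∈ B
  B_compl : ∀ p ∈ B, e - p ∈ B
  /-- `K_G(e) ⊆ B` -/
  KG_sub : ∀ p, IsComponent e p → p ∈ G → p ∈ B
  /-- `B` is order closed in `E`: if a (downward directed) net in `B` decreases to `p`
  in `E`, then `p ∈ B` -/
  B_orderClosed : ∀ S ⊆ B, S.Nonempty → DirectedOn (· ≥ ·) S → sInf S ∈ B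
  ψ_mem : ∀ p ∈ B, ψ p ∈ G
  /-- (i) `ψ(pq) = q ψ(p)` for `p ∈ B`, `q ∈ K_G(e)` -/
  ψ_mul : ∀ p ∈ B, ∀ q, IsComponent e q → q ∈ G → ψ (p ⊓ q) = bandProj q (ψ p)
  /-- (ii) additivity on disjoint components -/
  ψ_add : ∀ p ∈ B, ∀ q ∈ B, p ⊓ q = 0 → ψ (p ⊔ q) = ψ p + ψ q
  /-- (iii) order continuity: if a net `(p_α)` in `B` decreases to `p` in `E`, then
  `ψ(p_α) → ψ(p)` in order -/
  ψ_ordCont : ∀ S ⊆ B, S.Nonempty → DirectedOn (· ≥ ·) S →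
    ∃ w : E → E, (∀ p ∈ S, ∀ q ∈ S, p ≤ q → w p ≤ w q) ∧
      sInf (w '' S) = 0 ∧ ∀ p ∈ S, |ψ p - ψ (sInf S)| ≤ w p
  /-- (iv) `ψ` is order bounded -/
  ψ_bdd : ∃ g : E, 0 ≤ g ∧ ∀ p ∈ B, |ψ p| ≤ g

namespace HJSetup

variable {E : Type*} [AddCommGroup E] [ConditionallyCompleteLattice E]
  [CovariantClass E E (· + ·) (· ≤ ·)] [Module ℝ E] [PosSMulMono ℝ E]

/-- `C(q) = {ψ(p) : p ∈ B, p ≤ q}`. -/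
def C (s : HJSetup E) (q : E) : Set E := {y | ∃ p ∈ s.B, p ≤ q ∧ y = s.ψ p}

/-- `α(q) = sup C(q)`. -/
noncomputable def alpha (s : HJSetup E) (q : E) : E := sSup (s.C q)

/-- `M(q) = {p ∈ B : p ≤ q, 2ψ(p) ≥ p α(q)}`. -/
def M (s : HJSetup E) (q : E) : Set E :=
  {p | p ∈ s.B ∧ p ≤ q ∧ bandProj p (s.alpha q) ≤ s.ψ p + s.ψ p}

/-- `q` is strongly positive with respect to `ψ`. -/
def StronglyPos (s : HJSetup E) (q : E) : Prop := ∀ p ∈ s.B, p ≤ q → 0 ≤ s.ψ p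

/-- `q` is strongly negative with respect to `ψ`. -/
def StronglyNeg (s : HJSetup E) (q : E) : Prop := ∀ p ∈ s.B, p ≤ q → s.ψ p ≤ 0

/-- `H = {p ∈ B : p strongly negative w.r.t. ψ}`. -/
def H (s : HJSetup E) : Set E := {p | p ∈ s.B ∧ s.StronglyNeg p}

end HJSetup

section Lattice

variable {E : Type*} [AddCommGroup E] [ConditionallyCompleteLattice E]

theorem inf_eq_zero_of_le {a b c : E} (hb : 0 ≤ b) (hbc : b ≤ c)
    (h : a ⊓ c = 0) (ha : 0 ≤ a) : a ⊓ b = 0 :=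
  le_antisymm ((inf_le_inf_left a hbc).trans h.le) (le_inf ha hb)

/-- The band projection of a positive element `x` onto the band generated by `w ≥ 0`. -/
noncomputable def posBandProj (w x : E) : E := sSup (Set.range fun n : ℕ => x ⊓ n • w)

theorem bddAbove_range_inf_nsmul (w x : E) : BddAbove (Set.range fun n : ℕ => x ⊓ n • w) :=
  ⟨x, by rintro _ ⟨n, rfl⟩; exact inf_le_left⟩

theorem inf_nsmul_le_posBandProj (w x : E) (n : ℕ) : x ⊓ n • w ≤ posBandProj w x :=
  le_csSup (bddAbove_range_inf_nsmul w x) ⟨n, rfl⟩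

theorem posBandProj_le (w x : E) : posBandProj w x ≤ x :=
  csSup_le (Set.range_nonempty _) (by rintro _ ⟨n, rfl⟩; exact inf_le_left)

theorem posBandProj_nonneg {x : E} (w : E) (hx : 0 ≤ x) : 0 ≤ posBandProj w x := by
  simpa [hx] using inf_nsmul_le_posBandProj w x 0

end Lattice

theorem le_of_add_self_le {E : Type*} [AddCommGroup E] [Preorder E] [Module ℝ E]
    [PosSMulMono ℝ E] {a b : E} (h : a + a ≤ b + b) : a ≤ b := by
  have h1 := smul_le_smul_of_nonneg_left h (by norm_num : (0 : ℝ) ≤ 1 / 2)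
  have h2 : ∀ x : E, (1 / 2 : ℝ) • (x + x) = x := fun x => by
    rw [smul_add, ← add_smul]; norm_num
  rwa [h2, h2] at h1

section RieszSpace

variable {E : Type*} [AddCommGroup E] [ConditionallyCompleteLattice E]
  [CovariantClass E E (· + ·) (· ≤ ·)]

theorem inf_csSup_le_of_forall {S : Set E} {a b : E} (hne : S.Nonempty) (hS : BddAbove S)
    (h : ∀ x ∈ S, a ⊓ x ≤ b) : a ⊓ sSup S ≤ b := by
  have key : sSup S ≤ b + a ⊔ sSup S - a := by
    refine csSup_le hne fun x hx => ?_
    have h1 : x = a ⊓ x + a ⊔ x - a := by rw [inf_add_sup]; abel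
    rw [h1]
    exact sub_le_sub_right (add_le_add (h x hx) (sup_le_sup_left (le_csSup hS hx) a)) a
  have h2 : a ⊓ sSup S = a + sSup S - a ⊔ sSup S := by rw [← inf_add_sup a (sSup S)]; abel
  rw [h2]
  calc a + sSup S - a ⊔ sSup S ≤ a + (b + a ⊔ sSup S - a) - a ⊔ sSup S :=
        sub_le_sub_right (add_le_add_right key a) _
    _ = b := by abel

theorem inf_csSup_eq_zero {S : Set E} {a : E} (hne : S.Nonempty) (hS : BddAbove S) (ha : 0 ≤ a)
    (h0 : ∀ x ∈ S, 0 ≤ x) (h : ∀ x ∈ S, a ⊓ x = 0) : a ⊓ sSup S = 0 := by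
  obtain ⟨x, hx⟩ := hne
  exact le_antisymm (inf_csSup_le_of_forall ⟨x, hx⟩ hS fun y hy => (h y hy).le)
    (le_inf ha ((h0 x hx).trans (le_csSup hS hx)))

theorem inf_add_eq_zero {v a b : E} (hv : 0 ≤ v) (ha : 0 ≤ a) (hb : 0 ≤ b)
    (h₁ : v ⊓ a = 0) (h₂ : v ⊓ b = 0) : v ⊓ (a + b) = 0 := by
  refine le_antisymm ?_ (le_inf hv (add_nonneg ha hb))
  have h : v ⊓ (a + b) ≤ b := by
    calc v ⊓ (a + b) ≤ (v + b) ⊓ (a + b) := inf_le_inf_right _ (le_add_of_nonneg_right hb)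
      _ = v ⊓ a + b := (inf_add v a b).symm
      _ = b := by rw [h₁, zero_add]
  calc v ⊓ (a + b) ≤ v ⊓ b := le_inf inf_le_left h
    _ = 0 := h₂

theorem inf_nsmul_eq_zero {v w : E} (hv : 0 ≤ v) (hw : 0 ≤ w) (h : v ⊓ w = 0) (n : ℕ) :
    v ⊓ n • w = 0 := by
  induction n with
  | zero => simpa using hv
  | succ n ih => rw [succ_nsmul]; exact inf_add_eq_zero hv (nsmul_nonneg hw n) hw ih h

theorem sub_posBandProj_inf {w : E} (x : E) (hw : 0 ≤ w) : (x - posBandProj w x) ⊓ w = 0 := by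
  refine le_antisymm ?_ (le_inf (sub_nonneg.2 (posBandProj_le w x)) hw)
  set t := (x - posBandProj w x) ⊓ w with ht
  have h : posBandProj w x ≤ posBandProj w x - t := by
    refine csSup_le (Set.range_nonempty _) ?_
    rintro _ ⟨n, rfl⟩
    refine le_sub_iff_add_le.2 (le_trans (le_inf ?_ ?_) (inf_nsmul_le_posBandProj w x (n + 1)))
    · calc x ⊓ n • w + t ≤ posBandProj w x + (x - posBandProj w x) :=
            add_le_add (inf_nsmul_le_posBandProj w x n) inf_le_left
        _ = x := by abel
    · rw [succ_nsmul]
      exact add_le_add inf_le_right inf_le_right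
  simpa using h

theorem inf_posBandProj_eq_zero {v w x : E} (hv : 0 ≤ v) (hw : 0 ≤ w) (hx : 0 ≤ x)
    (h : v ⊓ w = 0) : v ⊓ posBandProj w x = 0 := by
  refine inf_csSup_eq_zero (Set.range_nonempty _) (bddAbove_range_inf_nsmul w x) hv ?_ ?_
  · rintro _ ⟨n, rfl⟩
    exact le_inf hx (nsmul_nonneg hw n)
  · rintro _ ⟨n, rfl⟩
    exact inf_eq_zero_of_le (le_inf hx (nsmul_nonneg hw n)) inf_le_right
      (inf_nsmul_eq_zero hv hw h n) hv

theorem bandProj_eq (u x : E) :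
    bandProj u x = posBandProj |u| (x ⊔ 0) - posBandProj |u| ((-x) ⊔ 0) := rfl

theorem bandProj_of_nonneg {u x : E} (hu : 0 ≤ u) (hx : 0 ≤ x) :
    bandProj u x = posBandProj u x := by
  have h0 : posBandProj u (0 : E) = 0 :=
    le_antisymm (posBandProj_le _ _) (posBandProj_nonneg _ le_rfl)
  rw [bandProj_eq, abs_of_nonneg hu, sup_eq_left.2 hx, sup_eq_right.2 (neg_nonpos.2 hx), h0,
    sub_zero]

theorem inf_abs_sub_bandProj {k : E} (x : E) (hk : 0 ≤ k) : k ⊓ |x - bandProj k x| = 0 := by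
  rw [bandProj_eq, abs_of_nonneg hk]
  set a := x ⊔ 0 - posBandProj k (x ⊔ 0) with ha
  set b := (-x) ⊔ 0 - posBandProj k ((-x) ⊔ 0) with hb
  have ha0 : 0 ≤ a := sub_nonneg.2 (posBandProj_le _ _)
  have hb0 : 0 ≤ b := sub_nonneg.2 (posBandProj_le _ _)
  have hx : x ⊔ 0 - (-x) ⊔ 0 = x := posPart_sub_negPart x
  have e1 : x - (posBandProj k (x ⊔ 0) - posBandProj k ((-x) ⊔ 0)) = a - b := by
    rw [ha, hb]; nth_rewrite 1 [← hx]; abel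
  rw [e1]
  have hle : |a - b| ≤ a + b := by
    refine abs_le'.2 ⟨?_, ?_⟩
    · exact (sub_le_self a hb0).trans (le_add_of_nonneg_right hb0)
    · rw [neg_sub]; exact (sub_le_self b ha0).trans (le_add_of_nonneg_left ha0)
  refine inf_eq_zero_of_le (abs_nonneg _) hle ?_ hk
  refine inf_add_eq_zero hk ha0 hb0 ?_ ?_ <;> rw [inf_comm] <;> exact sub_posBandProj_inf _ hk

theorem inf_abs_sub_eq_zero_of_bandProj_eq {k x y : E} (hk : 0 ≤ k)
    (h : bandProj k x = bandProj k y) : k ⊓ |x - y| = 0 := by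
  have hle : |x - y| ≤ |x - bandProj k x| + |y - bandProj k y| := by
    rw [h]
    refine abs_le'.2 ⟨?_, ?_⟩
    · calc x - y = (x - bandProj k y) + -(y - bandProj k y) := by abel
        _ ≤ _ := add_le_add (le_abs_self _) (neg_le_abs _)
    · calc -(x - y) = -(x - bandProj k y) + (y - bandProj k y) := by abel
        _ ≤ _ := add_le_add (neg_le_abs _) (le_abs_self _)
  exact inf_eq_zero_of_le (abs_nonneg _) hle
    (inf_add_eq_zero hk (abs_nonneg _) (abs_nonneg _) (inf_abs_sub_bandProj x hk)
      (inf_abs_sub_bandProj y hk)) hk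

namespace IsComponent

theorem compl {e p : E} (h : IsComponent e p) : IsComponent e (e - p) :=
  ⟨sub_nonneg.2 h.2.1, sub_le_self e h.1, by rw [sub_sub_cancel, inf_comm]; exact h.2.2⟩

theorem posBandProj {w e : E} (hw : 0 ≤ w) (he : 0 ≤ e) : IsComponent e (posBandProj w e) :=
  ⟨posBandProj_nonneg w he, posBandProj_le w e, by
    rw [inf_comm]
    exact inf_posBandProj_eq_zero (sub_nonneg.2 (posBandProj_le w e)) hw he
      (sub_posBandProj_inf e hw)⟩

theorem csSup {e : E} {S : Set E} (hne : S.Nonempty) (h : ∀ p ∈ S, IsComponent e p) :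
    IsComponent e (sSup S) := by
  have hb : BddAbove S := ⟨e, fun p hp => (h p hp).2.1⟩
  have hle : sSup S ≤ e := csSup_le hne fun p hp => (h p hp).2.1
  have h0 : 0 ≤ sSup S := by
    obtain ⟨p, hp⟩ := hne
    exact (h p hp).1.trans (le_csSup hb hp)
  refine ⟨h0, hle, ?_⟩
  rw [inf_comm]
  refine inf_csSup_eq_zero hne hb (sub_nonneg.2 hle) (fun p hp => (h p hp).1) fun p hp => ?_
  rw [inf_comm]
  exact inf_eq_zero_of_le (sub_nonneg.2 hle)
    (sub_le_sub_left (le_csSup hb hp) e) (h p hp).2.2 (h p hp).1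

end IsComponent

end RieszSpace

namespace HJSetup

variable {E : Type*} [AddCommGroup E] [ConditionallyCompleteLattice E]
  [CovariantClass E E (· + ·) (· ≤ ·)] [Module ℝ E] [PosSMulMono ℝ E] (s : HJSetup E)

theorem G_sub {x y : E} (hx : x ∈ s.G) (hy : y ∈ s.G) : x - y ∈ s.G := by
  rw [sub_eq_add_neg]
  exact s.G_add _ hx _ (s.G_neg _ hy)

theorem G_nsmul {x : E} (hx : x ∈ s.G) (n : ℕ) : n • x ∈ s.G := by
  induction n with
  | zero => simpa using s.G_zero
  | succ n ih => rw [succ_nsmul]; exact s.G_add _ ih _ hx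

theorem G_posBandProj {w x : E} (hw : w ∈ s.G) (hx : x ∈ s.G) : posBandProj w x ∈ s.G := by
  refine s.G_ded _ ?_ (Set.range_nonempty _) (bddAbove_range_inf_nsmul w x)
  rintro _ ⟨n, rfl⟩
  exact s.G_inf _ hx _ (s.G_nsmul hw n)

theorem eq_zero_of_posBandProj_eq_zero {w : E} (hw : 0 ≤ w) (h : posBandProj w s.e = 0) :
    w = 0 := by
  refine s.e_weak w hw (le_antisymm ?_ (le_inf hw s.e_pos.le))
  have := inf_nsmul_le_posBandProj w s.e 1
  rwa [one_nsmul, inf_comm, h] at this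

theorem ψ_zero : s.ψ 0 = 0 := by
  have h : IsComponent s.e 0 := s.B_comp 0 s.B_zero
  have h1 := s.ψ_mul 0 s.B_zero 0 h s.G_zero
  rw [inf_idem] at h1
  rw [h1, bandProj_eq]
  have h2 : ∀ x : E, 0 ≤ x → posBandProj |(0 : E)| x = 0 := fun x hx => by
    simp [posBandProj, hx]
  rw [h2 _ le_sup_right, h2 _ le_sup_right, sub_zero]

theorem inf_abs_ψ_sub_eq_zero {p p' k : E} (hp : p ∈ s.B) (hp' : p' ∈ s.B)
    (hk : IsComponent s.e k) (hkG : k ∈ s.G) (h : p ⊓ k = p' ⊓ k) :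
    k ⊓ |s.ψ p - s.ψ p'| = 0 :=
  inf_abs_sub_eq_zero_of_bandProj_eq hk.1 <| by
    rw [← s.ψ_mul p hp k hk hkG, ← s.ψ_mul p' hp' k hk hkG, h]

theorem bddAbove_C (q : E) : BddAbove (s.C q) := by
  obtain ⟨g, -, hg⟩ := s.ψ_bdd
  refine ⟨g, ?_⟩
  rintro _ ⟨p, hp, -, rfl⟩
  exact (le_abs_self _).trans (hg p hp)

theorem ψ_le_alpha {p q : E} (hp : p ∈ s.B) (hpq : p ≤ q) : s.ψ p ≤ s.alpha q :=
  le_csSup (s.bddAbove_C q) ⟨p, hp, hpq, rfl⟩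

theorem alpha_le {q a : E} (hq : q ∈ s.B) (h : ∀ p ∈ s.B, p ≤ q → s.ψ p ≤ a) :
    s.alpha q ≤ a := by
  refine csSup_le ⟨s.ψ q, q, hq, le_rfl, rfl⟩ ?_
  rintro _ ⟨p, hp, hpq, rfl⟩
  exact h p hp hpq

theorem alpha_mem {q : E} (hq : q ∈ s.B) : s.alpha q ∈ s.G := by
  refine s.G_ded _ ?_ ⟨s.ψ q, q, hq, le_rfl, rfl⟩ (s.bddAbove_C q)
  rintro _ ⟨p, hp, -, rfl⟩
  exact s.ψ_mem p hp

theorem alpha_nonneg {q : E} (hq : q ∈ s.B) : 0 ≤ s.alpha q := by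
  simpa [s.ψ_zero] using s.ψ_le_alpha s.B_zero (s.B_comp q hq).1

theorem csSup_mem_B {S : Set E} (hS : S ⊆ s.B) (hne : S.Nonempty) (hd : DirectedOn (· ≤ ·) S) :
    sSup S ∈ s.B := by
  have hb : BddAbove S := ⟨s.e, fun p hp => (s.B_comp p (hS hp)).2.1⟩
  have h : sInf ((fun p => s.e - p) '' S) ∈ s.B := by
    refine s.B_orderClosed _ ?_ (hne.image _) ?_
    · rintro _ ⟨p, hp, rfl⟩
      exact s.B_compl p (hS hp)
    · rintro _ ⟨p, hp, rfl⟩ _ ⟨p', hp', rfl⟩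
      obtain ⟨r, hr, h1, h2⟩ := hd p hp p' hp'
      exact ⟨_, ⟨r, hr, rfl⟩, sub_le_sub_left h1 _, sub_le_sub_left h2 _⟩
  have h1 : IsGLB ((fun p => s.e - p) '' S) (s.e - sSup S) := by
    refine ⟨?_, fun b hbb => ?_⟩
    · rintro _ ⟨p, hp, rfl⟩
      exact sub_le_sub_left (le_csSup hb hp) _
    · refine le_sub_comm.1 (csSup_le hne fun p hp => ?_)
      exact le_sub_comm.1 (hbb ⟨p, hp, rfl⟩)
  rw [h1.csInf_eq (hne.image _)] at h
  simpa using s.B_compl _ h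

/-- The part of `α(q)` that is not dominated by `2ψ(p)`. -/
noncomputable def deficit (q p : E) : E := (s.alpha q - (s.ψ p + s.ψ p)) ⊔ 0

theorem deficit_nonneg (q p : E) : 0 ≤ s.deficit q p := le_sup_right

theorem deficit_mem {q p : E} (hq : q ∈ s.B) (hp : p ∈ s.B) : s.deficit q p ∈ s.G :=
  s.G_sup _ (s.G_sub (s.alpha_mem hq) (s.G_add _ (s.ψ_mem p hp) _ (s.ψ_mem p hp))) _ s.G_zero

theorem deficit_local {q p p' k : E} (hp : p ∈ s.B) (hp' : p' ∈ s.B)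
    (hk : IsComponent s.e k) (hkG : k ∈ s.G) (h : p ⊓ k = p' ⊓ k)
    (hd : k ⊓ s.deficit q p = 0) : k ⊓ s.deficit q p' = 0 := by
  have h1 := s.inf_abs_ψ_sub_eq_zero hp hp' hk hkG h
  set d := |s.ψ p - s.ψ p'|
  have hd0 : 0 ≤ d := abs_nonneg _
  have hle : s.deficit q p' ≤ s.deficit q p + (d + d) := by
    refine sup_le ?_ (add_nonneg (s.deficit_nonneg q p) (add_nonneg hd0 hd0))
    have h2 : s.alpha q - (s.ψ p + s.ψ p) ≤ s.deficit q p := le_sup_left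
    have h3 : s.ψ p - s.ψ p' ≤ d := le_abs_self _
    calc s.alpha q - (s.ψ p' + s.ψ p')
        = s.alpha q - (s.ψ p + s.ψ p) + ((s.ψ p - s.ψ p') + (s.ψ p - s.ψ p')) := by abel
      _ ≤ _ := add_le_add h2 (add_le_add h3 h3)
  exact inf_eq_zero_of_le (s.deficit_nonneg q p') hle
    (inf_add_eq_zero hk.1 (s.deficit_nonneg q p) (add_nonneg hd0 hd0) hd
      (inf_add_eq_zero hk.1 hd0 hd0 h1 h1)) hk.1

/-- `p ≤ q` satisfies `α(q) ≤ 2ψ(p)` on the component `k` of `G`. -/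
structure IsHalfSolution (q p k : E) : Prop where
  mem : p ∈ s.B
  le : p ≤ q
  comp : IsComponent s.e k
  comp_mem : k ∈ s.G
  disj : k ⊓ s.deficit q p = 0

variable {s}

theorem isHalfSolution_zero {q : E} (hq : q ∈ s.B) : s.IsHalfSolution q 0 0 where
  mem := s.B_zero
  le := (s.B_comp q hq).1
  comp := s.B_comp 0 s.B_zero
  comp_mem := s.G_zero
  disj := inf_eq_left.2 (s.deficit_nonneg q 0)

theorem IsHalfSolution.inf_mem {q p k : E} (h : s.IsHalfSolution q p k) : p ⊓ k ∈ s.B :=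
  s.B_inf _ h.mem _ (s.KG_sub k h.comp h.comp_mem)

theorem exists_isHalfSolution_of_chain {q : E} {c : Set (E × E)} (hne : c.Nonempty)
    (hc : ∀ x ∈ c, s.IsHalfSolution q x.1 x.2)
    (hchain : ∀ x ∈ c, ∀ y ∈ c, (x.2 ≤ y.2 ∧ x.1 ⊓ x.2 = y.1 ⊓ x.2) ∨
      (y.2 ≤ x.2 ∧ y.1 ⊓ y.2 = x.1 ⊓ y.2)) :
    ∃ P K, s.IsHalfSolution q P K ∧ ∀ x ∈ c, x.2 ≤ K ∧ x.1 ⊓ x.2 = P ⊓ x.2 := by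
  set S : Set E := (fun x : E × E => x.1 ⊓ x.2) '' c
  set T : Set E := Prod.snd '' c
  have hSne : S.Nonempty := hne.image _
  have hTne : T.Nonempty := hne.image _
  have hSB : S ⊆ s.B := by
    rintro _ ⟨x, hx, rfl⟩
    exact (hc x hx).inf_mem
  have hSb : BddAbove S := ⟨s.e, fun p hp => (s.B_comp p (hSB hp)).2.1⟩
  have hTc : ∀ k ∈ T, IsComponent s.e k := by
    rintro _ ⟨x, hx, rfl⟩
    exact (hc x hx).comp
  have hTb : BddAbove T := ⟨s.e, fun p hp => (hTc p hp).2.1⟩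
  have hmono : ∀ x y : E × E, x.2 ≤ y.2 → x.1 ⊓ x.2 = y.1 ⊓ x.2 → x.1 ⊓ x.2 ≤ y.1 ⊓ y.2 := by
    intro x y h1 h2
    rw [h2]
    exact inf_le_inf_left _ h1
  have hSd : DirectedOn (· ≤ ·) S := by
    rintro _ ⟨x, hx, rfl⟩ _ ⟨y, hy, rfl⟩
    rcases hchain x hx y hy with ⟨h1, h2⟩ | ⟨h1, h2⟩
    · exact ⟨_, ⟨y, hy, rfl⟩, hmono x y h1 h2, le_rfl⟩
    · exact ⟨_, ⟨x, hx, rfl⟩, le_rfl, hmono y x h1 h2⟩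
  have hPB : sSup S ∈ s.B := s.csSup_mem_B hSB hSne hSd
  have hloc : ∀ x ∈ c, x.1 ⊓ x.2 = sSup S ⊓ x.2 := by
    intro x hx
    refine le_antisymm (le_inf (le_csSup hSb ⟨x, hx, rfl⟩) inf_le_right) ?_
    rw [inf_comm]
    refine inf_csSup_le_of_forall hSne hSb ?_
    rintro _ ⟨y, hy, rfl⟩
    rcases hchain x hx y hy with ⟨h1, h2⟩ | ⟨h1, h2⟩
    · rw [h2]
      exact le_inf (inf_le_right.trans inf_le_left) inf_le_left
    · exact inf_le_right.trans (hmono y x h1 h2)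
  refine ⟨sSup S, sSup T, ⟨hPB, ?_, IsComponent.csSup hTne hTc, ?_, ?_⟩, fun x hx =>
    ⟨le_csSup hTb ⟨x, hx, rfl⟩, hloc x hx⟩⟩
  · refine csSup_le hSne ?_
    rintro _ ⟨x, hx, rfl⟩
    exact inf_le_left.trans (hc x hx).le
  · refine s.G_ded _ ?_ hTne hTb
    rintro _ ⟨x, hx, rfl⟩
    exact (hc x hx).comp_mem
  · rw [inf_comm]
    refine inf_csSup_eq_zero hTne hTb (s.deficit_nonneg q _) (fun k hk => (hTc k hk).1) ?_
    rintro _ ⟨x, hx, rfl⟩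
    rw [inf_comm]
    exact s.deficit_local (hc x hx).mem hPB (hc x hx).comp (hc x hx).comp_mem (hloc x hx)
      (hc x hx).disj

theorem exists_maximal_isHalfSolution {q : E} (hq : q ∈ s.B) :
    ∃ p k, s.IsHalfSolution q p k ∧ ∀ p' k', s.IsHalfSolution q p' k' → k ≤ k' →
      p ⊓ k = p' ⊓ k → k' ≤ k := by
  let X := {x : E × E // s.IsHalfSolution q x.1 x.2}
  let r : X → X → Prop := fun x y => x.1.2 ≤ y.1.2 ∧ x.1.1 ⊓ x.1.2 = y.1.1 ⊓ x.1.2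
  have hrefl : ∀ x, r x x := fun x => ⟨le_rfl, rfl⟩
  have : Nonempty X := ⟨⟨(0, 0), isHalfSolution_zero hq⟩⟩
  obtain ⟨m, hm⟩ := exists_maximal_of_nonempty_chains_bounded (r := r) (by
    intro c hc hne
    obtain ⟨P, K, hPK, h⟩ := exists_isHalfSolution_of_chain (s := s) (q := q)
      (c := Subtype.val '' c) (hne.image _) (by rintro _ ⟨x, -, rfl⟩; exact x.2) (by
        rintro _ ⟨x, hx, rfl⟩ _ ⟨y, hy, rfl⟩
        by_cases hxy : x = y
        · subst hxy
          exact Or.inl (hrefl x)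
        · exact hc hx hy hxy)
    exact ⟨⟨(P, K), hPK⟩, fun x hx => h x.1 ⟨x, hx, rfl⟩⟩) (by
    rintro x y z ⟨h1, h2⟩ ⟨h3, h4⟩
    refine ⟨h1.trans h3, ?_⟩
    rw [h2, ← inf_eq_right.2 h1, ← inf_assoc, h4, inf_assoc])
  exact ⟨m.1.1, m.1.2, m.2, fun p' k' h h1 h2 => (hm ⟨(p', k'), h⟩ ⟨h1, h2⟩).1⟩

theorem eq_zero_of_maximal {q p k p₁ w : E}
    (h : s.IsHalfSolution q p k)
    (hmax : ∀ p' k', s.IsHalfSolution q p' k' → k ≤ k' → p ⊓ k = p' ⊓ k → k' ≤ k)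
    (hp₁ : p₁ ∈ s.B) (hp₁q : p₁ ≤ q) (hw : 0 ≤ w) (hwG : w ∈ s.G) (hwk : k ⊓ w = 0)
    (hwd : s.deficit q p₁ ⊓ w = 0) : w = 0 := by
  set k₁ := posBandProj w s.e
  have hk₁ : IsComponent s.e k₁ := IsComponent.posBandProj hw s.e_pos.le
  have hk₁G : k₁ ∈ s.G := s.G_posBandProj hwG s.e_mem
  have hkk₁ : k ⊓ k₁ = 0 := inf_posBandProj_eq_zero h.comp.1 hw s.e_pos.le hwk
  have hd : s.deficit q p₁ ⊓ k₁ = 0 :=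
    inf_posBandProj_eq_zero (s.deficit_nonneg q p₁) hw s.e_pos.le hwd
  have hp0 := (s.B_comp p h.mem).1
  have hp₁0 := (s.B_comp p₁ hp₁).1
  have hglue : ∀ {a b c d : E}, 0 ≤ a → 0 ≤ b → b ⊓ d = 0 →
      a ⊓ b = (a ⊓ b ⊔ c ⊓ d) ⊓ b := by
    intro a b c d ha hb hbd
    refine le_antisymm (le_inf le_sup_left inf_le_right) ?_
    rw [inf_comm, ← csSup_pair]
    refine inf_csSup_le_of_forall (Set.insert_nonempty _ _)
      ((Set.toFinite _).bddAbove) ?_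
    rintro x (rfl | rfl)
    · exact inf_le_right
    · exact ((inf_le_inf_left b inf_le_right).trans hbd.le).trans (le_inf ha hb)
  set p' := p ⊓ k ⊔ p₁ ⊓ k₁ with hp'
  have hp'B : p' ∈ s.B :=
    s.B_sup _ h.inf_mem _ (s.B_inf _ hp₁ _ (s.KG_sub _ hk₁ hk₁G))
  have e1 : p ⊓ k = p' ⊓ k := hglue hp0 h.comp.1 hkk₁
  have e2 : p₁ ⊓ k₁ = p' ⊓ k₁ := by
    rw [hp', sup_comm]
    exact hglue hp₁0 hk₁.1 (by rwa [inf_comm])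
  have hsup : k ⊔ k₁ = k + k₁ := by rw [← inf_add_sup k k₁, hkk₁, zero_add]
  have hsol : s.IsHalfSolution q p' (k ⊔ k₁) := by
    refine ⟨hp'B, sup_le (inf_le_left.trans h.le) (inf_le_left.trans hp₁q), ?_,
      s.G_sup _ h.comp_mem _ hk₁G, ?_⟩
    · rw [← csSup_pair]
      refine IsComponent.csSup (Set.insert_nonempty _ _) ?_
      rintro x (rfl | rfl)
      exacts [h.comp, hk₁]
    · rw [hsup, inf_comm]
      refine inf_add_eq_zero (s.deficit_nonneg q p') h.comp.1 hk₁.1 ?_ ?_ <;> rw [inf_comm]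
      · exact s.deficit_local h.mem hp'B h.comp h.comp_mem e1 h.disj
      · exact s.deficit_local hp₁ hp'B hk₁ hk₁G e2 (by rwa [inf_comm])
  have hle : k₁ ≤ k := le_sup_right.trans (hmax p' _ hsol le_sup_left e1)
  exact s.eq_zero_of_posBandProj_eq_zero hw (by rwa [inf_eq_right.2 hle] at hkk₁)

theorem exists_alpha_le_two_ψ {q : E} (hq : q ∈ s.B) :
    ∃ p ∈ s.B, p ≤ q ∧ s.alpha q ≤ s.ψ p + s.ψ p := by
  obtain ⟨p, k, h, hmax⟩ := exists_maximal_isHalfSolution hq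
  refine ⟨p, h.mem, h.le, ?_⟩
  set a := s.alpha q with ha
  have ha0 : 0 ≤ a := s.alpha_nonneg hq
  set z := s.deficit q p
  have hz0 : 0 ≤ z := s.deficit_nonneg q p
  have hzG : z ∈ s.G := s.deficit_mem hq h.mem
  have hexc : ∀ p₁ ∈ s.B, p₁ ≤ q → ((s.ψ p₁ + s.ψ p₁ - a) ⊔ 0) ⊓ z = 0 := by
    intro p₁ hp₁ hp₁q
    set y := (s.ψ p₁ + s.ψ p₁ - a) ⊔ 0 with hy
    have hy0 : 0 ≤ y := le_sup_right
    have hyG : y ∈ s.G := s.G_sup _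
      (s.G_sub (s.G_add _ (s.ψ_mem _ hp₁) _ (s.ψ_mem _ hp₁)) (s.alpha_mem hq)) _ s.G_zero
    refine eq_zero_of_maximal h hmax hp₁ hp₁q (le_inf hy0 hz0) (s.G_inf _ hyG _ hzG)
      (inf_eq_zero_of_le (le_inf hy0 hz0) inf_le_right h.disj h.comp.1) ?_
    refine inf_eq_zero_of_le (le_inf hy0 hz0) inf_le_left ?_ (s.deficit_nonneg q p₁)
    have := posPart_inf_negPart_eq_zero (a - (s.ψ p₁ + s.ψ p₁))
    rwa [negPart_def, neg_sub] at this
  have haz : a ⊓ z = 0 := by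
    set d := a ⊓ z with hd
    have hd0 : 0 ≤ d := le_inf ha0 hz0
    refine le_antisymm ?_ hd0
    have hle : a ≤ a - (1 / 2 : ℝ) • d := by
      refine s.alpha_le hq fun p₁ hp₁ hp₁q => ?_
      have h1 := hexc p₁ hp₁ hp₁q
      have hψa : s.ψ p₁ ≤ a := s.ψ_le_alpha hp₁ hp₁q
      set y := (s.ψ p₁ + s.ψ p₁ - a) ⊔ 0 with hy
      have hy0 : 0 ≤ y := le_sup_right
      have hya : y ≤ a := sup_le (sub_le_iff_le_add.2 (add_le_add hψa hψa)) ha0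
      have hyd : y ⊓ d = 0 := inf_eq_zero_of_le hd0 inf_le_right h1 hy0
      have hsum : y + d ≤ a := by
        rw [← inf_add_sup, hyd, zero_add]
        exact sup_le hya inf_le_left
      apply le_of_add_self_le
      have hhalf : (1 / 2 : ℝ) • d + (1 / 2 : ℝ) • d = d := by
        rw [← add_smul]; norm_num
      calc s.ψ p₁ + s.ψ p₁ = (s.ψ p₁ + s.ψ p₁ - a) + a := by abel
        _ ≤ y + a := add_le_add_left le_sup_left a
        _ ≤ (a - d) + a := add_le_add_left (le_sub_iff_add_le.2 hsum) a
        _ = (a - (1 / 2 : ℝ) • d) + (a - (1 / 2 : ℝ) • d) := by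
          nth_rewrite 1 [← hhalf]; abel
    have hneg : (1 / 2 : ℝ) • d ≤ 0 := by simpa using hle
    have hhalf : (1 / 2 : ℝ) • d + (1 / 2 : ℝ) • d = d := by
      rw [← add_smul]; norm_num
    rw [← hhalf]
    exact add_nonpos hneg hneg
  have hz : z = 0 := by
    refine eq_zero_of_maximal h hmax s.B_zero (s.B_comp q hq).1 hz0 hzG h.disj ?_
    rw [deficit, s.ψ_zero, add_zero, sub_zero, sup_eq_left.2 ha0]
    exact haz
  exact sub_nonpos.1 (le_sup_left.trans hz.le)

theorem ψ_inf_posBandProj {p : E} (hp : p ∈ s.B) (h0 : 0 ≤ s.ψ p) :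
    s.ψ (p ⊓ posBandProj (s.ψ p) s.e) = s.ψ p := by
  set h := posBandProj (s.ψ p) s.e
  have hh : IsComponent s.e h := IsComponent.posBandProj h0 s.e_pos.le
  have hhG : h ∈ s.G := s.G_posBandProj (s.ψ_mem p hp) s.e_mem
  rw [s.ψ_mul p hp h hh hhG]
  have h1 : h ⊓ |s.ψ p - bandProj h (s.ψ p)| = 0 := inf_abs_sub_bandProj _ hh.1
  rw [bandProj_of_nonneg hh.1 h0] at h1 ⊢
  have hle := sub_nonneg.2 (posBandProj_le h (s.ψ p))
  rw [abs_of_nonneg hle] at h1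
  have h2 : (s.e - h) ⊓ (s.ψ p - posBandProj h (s.ψ p)) = 0 :=
    inf_eq_zero_of_le hle (sub_le_self _ (posBandProj_nonneg h h0))
      (sub_posBandProj_inf s.e h0) hh.compl.1
  rw [inf_comm] at h1 h2
  have h3 := inf_add_eq_zero hle hh.1 hh.compl.1 h1 h2
  rw [add_sub_cancel] at h3
  exact (sub_eq_zero.1 (s.e_weak _ hle h3)).symm

end HJSetup

/-- For each `q ∈ B` there exists `u ∈ B` with `u ≤ P_{ψ(u)} q`,
`ψ(u) ≥ 0` and `ψ(u) ≤ α(q) ≤ 2ψ(u)`, where `P_{ψ(u)}` is the band projection onto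
the band in `E` generated by `ψ(u)`. -/
theorem hj_cor_neg {E : Type*} [AddCommGroup E]
    [ConditionallyCompleteLattice E] [CovariantClass E E (· + ·) (· ≤ ·)]
    [Module ℝ E] [PosSMulMono ℝ E] (s : HJSetup E) (q : E) (hq : q ∈ s.B) :
    ∃ u ∈ s.B, u ≤ bandProj (s.ψ u) q ∧ 0 ≤ s.ψ u ∧
      s.ψ u ≤ s.alpha q ∧ s.alpha q ≤ s.ψ u + s.ψ u := by
  obtain ⟨p, hp, hpq, hα⟩ := HJSetup.exists_alpha_le_two_ψ hq
  have h0 : 0 ≤ s.ψ p := le_of_add_self_le (by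
    rw [add_zero]
    exact (s.alpha_nonneg hq).trans hα)
  have hψ := HJSetup.ψ_inf_posBandProj hp h0
  have hG := s.G_posBandProj (s.ψ_mem p hp) s.e_mem
  have hcomp := IsComponent.posBandProj h0 s.e_pos.le
  refine ⟨p ⊓ posBandProj (s.ψ p) s.e, s.B_inf _ hp _ (s.KG_sub _ hcomp hG), ?_, ?_⟩
  · rw [hψ, bandProj_of_nonneg h0 (s.B_comp q hq).1]
    refine inf_csSup_le_of_forall (Set.range_nonempty _) (bddAbove_range_inf_nsmul _ _) ?_
    rintro _ ⟨n, rfl⟩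
    exact le_trans (le_inf (inf_le_left.trans hpq) (inf_le_right.trans inf_le_right))
      (inf_nsmul_le_posBandProj (s.ψ p) q n)
  · rw [hψ]
    exact ⟨h0, s.ψ_le_alpha hp hpq, hα⟩
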